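/- Let n ≥ 3 be an integer and let a > 0, b > 0, q ≥ 1 and μ be real constants with max{−a, −b} < μ < 0, and set δ = μ / max{−a, −b} (so 0 < δ < 1). Let p be a real constant with 0 < p < (4/(n−1))·(1 − δ). Then there exists a constant C > 0, depending only on n, p and δ, such that for every R > 0 and every smooth function v on ℝⁿ that is positive on the open ball B(0,R) and satisfies Δv + μ·v + a·v^{p+1} + b·v^{1−q} = 0 on B(0,R), one has |∇v(x)|²/v(x)² ≤ C/R² for every x in the ball B(0,R/2). (This is the Euclidean case κ = 0 of Theorem 2.) -/

import Mathlib

open Real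

/-- The Euclidean Laplace operator: sum of second partial derivatives. -/
noncomputable def lap {n : ℕ} (v : EuclideanSpace ℝ (Fin n) → ℝ)
    (x : EuclideanSpace ℝ (Fin n)) : ℝ :=
  ∑ i, fderiv ℝ (fun y => fderiv ℝ v y (EuclideanSpace.single i 1)) x
    (EuclideanSpace.single i 1)

/-- partial derivative -/
noncomputable def pd {n : ℕ} (i : Fin n) (v : EuclideanSpace ℝ (Fin n) → ℝ)
    (x : EuclideanSpace ℝ (Fin n)) : ℝ := fderiv ℝ v x (EuclideanSpace.single i 1)

section pdcalc
variable {n : ℕ} {U : Set (EuclideanSpace ℝ (Fin n))} {x : EuclideanSpace ℝ (Fin n)}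
  {f g : EuclideanSpace ℝ (Fin n) → ℝ}

theorem pd_mul (i : Fin n) (hf : DifferentiableAt ℝ f x) (hg : DifferentiableAt ℝ g x) :
    pd i (fun y => f y * g y) x = f x * pd i g x + g x * pd i f x := by
  unfold pd
  rw [fderiv_fun_mul hf hg]; simp

theorem pd_add (i : Fin n) (hf : DifferentiableAt ℝ f x) (hg : DifferentiableAt ℝ g x) :
    pd i (fun y => f y + g y) x = pd i f x + pd i g x := by
  unfold pd
  rw [fderiv_fun_add hf hg]; simp

theorem pd_const_mul (i : Fin n) (c : ℝ) (hf : DifferentiableAt ℝ f x) :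
    pd i (fun y => c * f y) x = c * pd i f x := by
  unfold pd
  rw [fderiv_const_mul hf]; simp

theorem pd_neg (i : Fin n) :
    pd i (fun y => - f y) x = - pd i f x := by
  unfold pd
  rw [fderiv_fun_neg]; simp

theorem pd_sum {ι : Type*} (s : Finset ι) (i : Fin n) {h : ι → EuclideanSpace ℝ (Fin n) → ℝ}
    (hf : ∀ j ∈ s, DifferentiableAt ℝ (h j) x) :
    pd i (fun y => ∑ j ∈ s, h j y) x = ∑ j ∈ s, pd i (h j) x := by
  unfold pd
  rw [fderiv_fun_sum hf]; simp

theorem pd_comp (i : Fin n) {k : ℝ → ℝ} {k' : ℝ} (hk : HasDerivAt k k' (f x))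
    (hf : DifferentiableAt ℝ f x) :
    pd i (fun y => k (f y)) x = k' * pd i f x := by
  unfold pd
  have := hk.comp_hasFDerivAt x hf.hasFDerivAt
  have h2 : fderiv ℝ (fun y => k (f y)) x = k' • fderiv ℝ f x := this.fderiv
  rw [h2]; simp

theorem pd_congr (hU : IsOpen U) (hx : x ∈ U) (h : ∀ y ∈ U, f y = g y) (i : Fin n) :
    pd i f x = pd i g x := by
  unfold pd
  have : f =ᶠ[nhds x] g := by
    filter_upwards [hU.mem_nhds hx] with y hy using h y hy
  rw [this.fderiv_eq]

theorem pd_coord (i j : Fin n) :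
    pd i (fun y => y j) x = if j = i then 1 else 0 := by
  unfold pd
  have : fderiv ℝ (fun y : EuclideanSpace ℝ (Fin n) => y j) x
      = EuclideanSpace.proj j := (EuclideanSpace.proj (𝕜 := ℝ) j).fderiv
  rw [this]; simp

theorem pd_smooth (hU : IsOpen U) (hf : ContDiffOn ℝ (⊤ : ℕ∞) f U) (i : Fin n) :
    ContDiffOn ℝ (⊤ : ℕ∞) (pd i f) U := by
  have := hf.fderiv_of_isOpen (m := (⊤ : ℕ∞)) hU (by simp)
  exact this.clm_apply contDiffOn_const

theorem sm_diff (hU : IsOpen U) (hf : ContDiffOn ℝ (⊤ : ℕ∞) f U) (hx : x ∈ U) :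
    DifferentiableAt ℝ f x :=
  (hf.contDiffAt (hU.mem_nhds hx)).differentiableAt (by simp)

theorem pd_comm (hU : IsOpen U) (hf : ContDiffOn ℝ (⊤ : ℕ∞) f U) (hx : x ∈ U) (i j : Fin n) :
    pd i (pd j f) x = pd j (pd i f) x := by
  have h0 := hf.contDiffAt (hU.mem_nhds hx)
  have hs : IsSymmSndFDerivAt ℝ f x := h0.isSymmSndFDerivAt (by
    simp only [minSmoothness_of_isRCLikeNormedField]
    exact WithTop.coe_le_coe.2 le_top)
  have hd : DifferentiableAt ℝ (fderiv ℝ f) x := 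
    (h0.fderiv_right (m := 1) (by exact WithTop.coe_le_coe.2 le_top)).differentiableAt (by simp)
  have key : ∀ k l : Fin n, pd k (pd l f) x =
      fderiv ℝ (fderiv ℝ f) x (EuclideanSpace.single k 1) (EuclideanSpace.single l 1) := by
    intro k l
    unfold pd
    rw [fderiv_clm_apply hd (differentiableAt_const _)]
    simp
  rw [key, key, hs]

theorem pd_pd_nonpos (hU : IsOpen U) (hf : ContDiffOn ℝ (⊤ : ℕ∞) f U) (hx : x ∈ U) (i : Fin n)
    (hm : IsLocalMax f x) : pd i (pd i f) x ≤ 0 := by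
  by_contra! hpos
  set e : EuclideanSpace ℝ (Fin n) := EuclideanSpace.single i 1 with he
  set L : ℝ → EuclideanSpace ℝ (Fin n) := fun s => x + s • e with hL
  have hL0 : L 0 = x := by simp [hL]
  have hLd : ∀ s, HasDerivAt L e s := by
    intro s
    have := ((hasDerivAt_id s).smul_const e).const_add x
    simp only [one_smul] at this
    exact this
  have hLc : Continuous L := by fun_prop
  have hev : ∀ᶠ s in nhds (0:ℝ), L s ∈ U := 
    hLc.continuousAt.eventually_mem (by rw [hL0]; exact hU.mem_nhds hx)
  have hder : ∀ (h : EuclideanSpace ℝ (Fin n) → ℝ) s, DifferentiableAt ℝ h (L s) →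
      HasDerivAt (fun s => h (L s)) (pd i h (L s)) s := fun h s hh =>
    hh.hasFDerivAt.comp_hasDerivAt s (hLd s)
  have hd1 : deriv (fun s => f (L s)) =ᶠ[nhds 0] fun s => pd i f (L s) := by
    filter_upwards [hev] with s hs
    exact (hder f s (sm_diff hU hf hs)).deriv
  have hd2 : deriv (deriv (fun s => f (L s))) 0 = pd i (pd i f) x := by
    rw [hd1.deriv_eq]
    have := (hder (pd i f) 0 (sm_diff hU (pd_smooth hU hf i) (by rwa [hL0]))).deriv
    rwa [hL0] at this
  have hd0 : deriv (fun s => f (L s)) 0 = 0 := by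
    rw [hd1.self_of_nhds]; show pd i f (L 0) = 0; rw [hL0]
    unfold pd; rw [hm.fderiv_eq_zero]; simp
  have hmin : IsLocalMin (fun s => f (L s)) 0 := 
    isLocalMin_of_deriv_deriv_pos (by rwa [hd2]) hd0 
      (hder f 0 (sm_diff hU hf (by rwa [hL0]))).continuousAt
  have hmax : IsLocalMax (fun s => f (L s)) 0 := by
    have : Filter.Tendsto L (nhds 0) (nhds x) := by
      have := hLc.tendsto 0
      rwa [hL0] at this
    have := this.eventually hm
    filter_upwards [this] with s hs
    simpa [hL0] using hs
  have hc : (fun s => f (L s)) =ᶠ[nhds 0] fun _ => f (L 0) := by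
    filter_upwards [hmin, hmax] with s h1 h2 using le_antisymm h2 h1
  have : deriv (deriv (fun s => f (L s))) 0 = 0 := by
    rw [hc.deriv.deriv_eq]; simp
  linarith

theorem grad_sq (f : EuclideanSpace ℝ (Fin n) → ℝ) (x : EuclideanSpace ℝ (Fin n)) :
    ‖gradient f x‖ ^ 2 = ∑ i, (pd i f x) ^ 2 := by
  rw [EuclideanSpace.norm_sq_eq]
  refine Finset.sum_congr rfl fun i _ => ?_
  have : gradient f x i = pd i f x := by
    have h1 : inner ℝ (gradient f x) (EuclideanSpace.single i (1:ℝ)) = pd i f x := by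
      unfold gradient pd
      rw [InnerProductSpace.toDual_symm_apply]
    rw [← h1, EuclideanSpace.inner_single_right]; simp
  rw [this]; simp

end pdcalc

/-- refined Hessian inequality -/
theorem hess_ineq {n : ℕ} (hn : 3 ≤ n) (H : Fin n → Fin n → ℝ) (u : Fin n → ℝ) (F t T : ℝ)
    (hF : 0 < F) (hu : ∑ i, u i ^ 2 = F) (ht : ∑ i, ∑ j, H i j * (u i * u j) = F * t)
    (hT : ∑ i, H i i = T) :
    t ^ 2 + (T - t) ^ 2 / ((n : ℝ) - 1) ≤ ∑ i, ∑ j, H i j ^ 2 := by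
  have hN : (0:ℝ) < (n:ℝ) - 1 := by
    have : (3:ℝ) ≤ n := by exact_mod_cast hn
    linarith
  set s := (T - t) / ((n:ℝ) - 1) with hs
  have h0 : 0 ≤ ∑ i, ∑ j, (H i j - (t - s) / F * (u i * u j) - s * (if i = j then 1 else 0)) ^ 2 :=
    Finset.sum_nonneg fun i _ => Finset.sum_nonneg fun j _ => sq_nonneg _
  set k := (t - s) / F with hk
  have hkF : k * F = t - s := by rw [hk]; field_simp
  have hsN : s * ((n:ℝ) - 1) = T - t := by rw [hs]; field_simp
  have e1 : ∑ i, ∑ j, (H i j - k * (u i * u j) - s * (if i = j then 1 else 0)) ^ 2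
      = ∑ i, ∑ j, H i j ^ 2 - 2 * k * (∑ i, ∑ j, H i j * (u i * u j)) - 2 * s * ∑ i, H i i
        + k ^ 2 * ((∑ i, u i ^ 2) * ∑ j, u j ^ 2) + 2 * k * s * (∑ i, u i ^ 2) + s ^ 2 * n := by
    have : ∀ i j, (H i j - k * (u i * u j) - s * (if i = j then 1 else 0)) ^ 2
      = H i j ^ 2 - 2 * k * (H i j * (u i * u j)) + k ^ 2 * (u i ^ 2 * u j ^ 2) + 
        (if i = j then - 2 * s * H i j + 2 * k * s * (u i * u j) + s ^ 2 else 0) := by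
      intro i j
      split_ifs <;> ring
    simp only [this, Finset.sum_add_distrib, Finset.sum_sub_distrib, Finset.sum_ite_eq,
      Finset.mem_univ, if_true, ← Finset.mul_sum, ← Finset.sum_mul]
    simp [← pow_two]
    ring
  rw [e1, hu, ht, hT] at h0
  have e2 : (T - t) ^ 2 / ((n:ℝ) - 1) = s ^ 2 * ((n:ℝ) - 1) := by
    rw [hs]; field_simp
  rw [e2]
  have e3 : T = s * ((n:ℝ) - 1) + t := by linarith
  have e4 : t = k * F + s := by linarith
  rw [e3] at h0
  generalize (n:ℝ) = N at *
  nlinarith [h0]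

theorem real_core (N F f f' t T H2 LF m g K θ : ℝ) (hN : 2 ≤ N) (hF : 0 < F) (hf : 0 ≤ f)
    (hθ : 0 < θ) (hg : 0 ≤ g) (hgF : g ^ 2 = F) (hm : 0 ≤ m) (hK : 0 ≤ K)
    (h1 : t ^ 2 + (T - t) ^ 2 / N ≤ H2) (hT : T = -(F + f))
    (h2 : LF = 2 * (H2 - 2 * F * t - f' * F))
    (h3 : θ * (F + f) ^ 2 ≤ (F + f) ^ 2 - N * f' * F)
    (h4 : LF ≤ K * m ^ 2 * F) (h5 : |t| ≤ 2 * m * g) :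
    F ≤ (N / θ * K + 36 * (N / θ) ^ 2) * m ^ 2 := by
  have hN0 : 0 < N := by linarith
  set S := F + f with hS
  have hS0 : 0 < S := by linarith
  have hFS : F ≤ S := by linarith
  have hb := abs_le.1 h5
  have hmg : 0 ≤ m * g := mul_nonneg hm hg
  have e1 : (T - t) ^ 2 / N * N = (S + t) ^ 2 := by rw [hT]; field_simp; ring
  have a1 : N * (t ^ 2) + (S + t) ^ 2 ≤ N * H2 := by
    have := mul_le_mul_of_nonneg_left h1 hN0.le
    rw [← e1]; linarith
  have a2 : N * H2 ≤ N * (K * m ^ 2 * F / 2 + 2 * F * t + f' * F) := 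
    mul_le_mul_of_nonneg_left (by linarith) hN0.le
  have a3 : θ * S ^ 2 ≤ N * (K * m ^ 2 * F / 2 + 2 * F * t) - 2 * S * t := by
    have b0 := mul_nonneg hN0.le (sq_nonneg t)
    have b1 := sq_nonneg t
    have b2 : (S + t) ^ 2 = S ^ 2 + 2 * S * t + t ^ 2 := by ring
    have b3 : N * (K * m ^ 2 * F / 2 + 2 * F * t + f' * F)
      = N * (K * m ^ 2 * F / 2 + 2 * F * t) + N * f' * F := by ring
    linarith
  have a4 : F * t ≤ S * (2 * (m * g)) := by
    calc F * t ≤ F * (2 * (m * g)) := mul_le_mul_of_nonneg_left (by linarith) hF.le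
      _ ≤ _ := mul_le_mul_of_nonneg_right hFS (by linarith)
  have a5 : -(S * t) ≤ S * (2 * (m * g)) := by
    have := mul_le_mul_of_nonneg_left (show -t ≤ 2 * (m * g) by linarith) hS0.le
    linarith
  have a6 : K * m ^ 2 * F ≤ K * m ^ 2 * S := 
    mul_le_mul_of_nonneg_left hFS (by positivity)
  have a7 : θ * S ^ 2 ≤ S * (N * (K * m ^ 2 / 2 + 6 * (m * g))) := by
    have b1 : N * (K * m ^ 2 * F / 2 + 2 * F * t) ≤ N * (K * m ^ 2 * S / 2 + 2 * (S * (2 * (m * g)))) :=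
      mul_le_mul_of_nonneg_left (by linarith) hN0.le
    have b2 : 0 ≤ S * (m * g) * (N - 2) := by
      apply mul_nonneg (by positivity); linarith
    have b3 : S * (N * (K * m ^ 2 / 2 + 6 * (m * g))) =
      N * (K * m ^ 2 * S / 2 + 2 * (S * (2 * (m * g)))) + 2 * (S * (2 * (m * g)))
        + 2 * (S * (m * g) * (N - 2)) := by ring
    linarith
  have a8 : θ * S ≤ N * (K * m ^ 2 / 2 + 6 * (m * g)) := by
    have : S * (θ * S) ≤ S * (N * (K * m ^ 2 / 2 + 6 * (m * g))) := by linarith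
    exact le_of_mul_le_mul_left this hS0
  have a9 : S ≤ N / θ * (K * m ^ 2 / 2 + 6 * (m * g)) := by
    rw [div_mul_eq_mul_div, le_div_iff₀ hθ]; linarith
  generalize N / θ = k at *
  have b1 := sq_nonneg (g - 6 * k * m)
  have b2 : (g - 6 * k * m) ^ 2 = F - 12 * k * m * g + 36 * k ^ 2 * m ^ 2 := by
    rw [← hgF]; ring
  have b3 : k * (K * m ^ 2 / 2 + 6 * (m * g)) = k * K * m ^ 2 / 2 + 6 * k * m * g := by ring
  linarith

section bochner
variable {n : ℕ} {U : Set (EuclideanSpace ℝ (Fin n))} {x : EuclideanSpace ℝ (Fin n)}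

/-- squared norm of the gradient -/
noncomputable def gsq (w : EuclideanSpace ℝ (Fin n) → ℝ) (y : EuclideanSpace ℝ (Fin n)) : ℝ :=
  ∑ i, pd i w y * pd i w y

theorem gsq_smooth (hU : IsOpen U) {w : EuclideanSpace ℝ (Fin n) → ℝ}
    (hw : ContDiffOn ℝ (⊤ : ℕ∞) w U) : ContDiffOn ℝ (⊤ : ℕ∞) (gsq w) U :=
  ContDiffOn.sum fun i _ => (pd_smooth hU hw i).mul (pd_smooth hU hw i)

theorem pd_gsq (hU : IsOpen U) {w : EuclideanSpace ℝ (Fin n) → ℝ}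
    (hw : ContDiffOn ℝ (⊤ : ℕ∞) w U) (hx : x ∈ U) (k : Fin n) :
    pd k (gsq w) x = ∑ i, 2 * (pd i w x * pd k (pd i w) x) := by
  have hd : ∀ i, DifferentiableAt ℝ (pd i w) x := fun i => sm_diff hU (pd_smooth hU hw i) hx
  unfold gsq
  rw [pd_sum _ _ (fun j _ => (hd j).fun_mul (hd j))]
  refine Finset.sum_congr rfl fun i _ => ?_
  rw [pd_mul k (hd i) (hd i)]; ring

theorem bochner (hU : IsOpen U) {w φ : EuclideanSpace ℝ (Fin n) → ℝ} {f' : ℝ}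
    (hw : ContDiffOn ℝ (⊤ : ℕ∞) w U) (hx : x ∈ U) (hφ : DifferentiableAt ℝ φ x)
    (hφ' : ∀ i, pd i φ x = f' * pd i w x)
    (heq : ∀ y ∈ U, ∑ i, pd i (pd i w) y = -(gsq w y + φ y)) :
    ∑ k, pd k (pd k (gsq w)) x = 2 * (∑ k, ∑ i, (pd k (pd i w) x) ^ 2
      - 2 * (∑ k, ∑ i, pd k (pd i w) x * (pd k w x * pd i w x)) - f' * gsq w x) := by
  have s1 := fun i => pd_smooth hU hw i
  have s2 := fun k i => pd_smooth hU (s1 i) k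
  have d1 : ∀ i, DifferentiableAt ℝ (pd i w) x := fun i => sm_diff hU (s1 i) hx
  have d2 : ∀ k i, DifferentiableAt ℝ (pd k (pd i w)) x := fun k i => sm_diff hU (s2 k i) hx
  have a1 : ∀ k, pd k (pd k (gsq w)) x = ∑ i, 2 * (pd i w x * pd k (pd k (pd i w)) x
      + (pd k (pd i w) x) ^ 2) := by
    intro k
    rw [pd_congr hU hx (fun y hy => pd_gsq hU hw hy k) k,
      pd_sum _ _ (fun j _ => ((d1 j).fun_mul (d2 k j)).const_mul 2)]
    refine Finset.sum_congr rfl fun i _ => ?_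
    rw [pd_const_mul k 2 ((d1 i).fun_mul (d2 k i)), pd_mul k (d1 i) (d2 k i)]; ring
  have a2 : ∀ i k, pd k (pd k (pd i w)) x = pd i (pd k (pd k w)) x := by
    intro i k
    rw [pd_congr hU hx (fun y hy => pd_comm hU hw hy k i) k, pd_comm hU (s1 k) hx]
  have a3 : ∀ i, ∑ k, pd k (pd k (pd i w)) x = -(pd i (gsq w) x + f' * pd i w x) := by
    intro i
    simp only [a2]
    rw [← pd_sum _ _ (fun j _ => d2 j j), pd_congr hU hx heq i, pd_neg,
      pd_add i (sm_diff hU (gsq_smooth hU hw) hx) hφ, hφ']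
  have a4 : ∑ k, ∑ i, pd i w x * pd k (pd k (pd i w)) x
      = - 2 * (∑ k, ∑ i, pd k (pd i w) x * (pd k w x * pd i w x)) - f' * gsq w x := by
    rw [Finset.sum_comm]
    simp only [← Finset.mul_sum, a3, pd_gsq hU hw hx]
    unfold gsq
    rw [Finset.mul_sum, Finset.mul_sum, ← Finset.sum_sub_distrib]
    refine Finset.sum_congr rfl fun i _ => ?_
    have : ∑ j, pd i (pd j w) x * (pd i w x * pd j w x)
        = pd i w x * ∑ j, pd j w x * pd i (pd j w) x := by
      rw [Finset.mul_sum]; exact Finset.sum_congr rfl fun j _ => by ring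
    rw [this]; ring
  simp only [a1, ← Finset.mul_sum, Finset.sum_add_distrib]
  rw [a4]; ring

/-- cutoff -/
noncomputable def cut (ρ : ℝ) (y : EuclideanSpace ℝ (Fin n)) : ℝ := ρ ^ 2 - ‖y‖ ^ 2

theorem cut_smooth (ρ : ℝ) : ContDiff ℝ (⊤ : ℕ∞) (cut ρ : EuclideanSpace ℝ (Fin n) → ℝ) :=
  contDiff_const.sub (contDiff_norm_sq ℝ)

theorem coord_smooth (j : Fin n) :
    ContDiff ℝ (⊤ : ℕ∞) (fun y : EuclideanSpace ℝ (Fin n) => y j) :=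
  (EuclideanSpace.proj (𝕜 := ℝ) j).contDiff

theorem coord_diff (j : Fin n) (x : EuclideanSpace ℝ (Fin n)) :
    DifferentiableAt ℝ (fun y : EuclideanSpace ℝ (Fin n) => y j) x :=
  (coord_smooth j).differentiable (by simp) x

theorem cut_diff (ρ : ℝ) (x : EuclideanSpace ℝ (Fin n)) :
    DifferentiableAt ℝ (cut ρ) x :=
  (cut_smooth ρ).differentiable (by simp) x

theorem pd_cut (ρ : ℝ) (i : Fin n) (x : EuclideanSpace ℝ (Fin n)) :
    pd i (cut ρ) x = (-2) * x i := by
  have : (cut ρ : EuclideanSpace ℝ (Fin n) → ℝ)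
      = fun y => ρ ^ 2 + -(∑ j, y j * y j) := by
    funext y
    unfold cut
    rw [EuclideanSpace.norm_sq_eq]
    simp [← pow_two, sub_eq_add_neg]
  rw [this, pd_add i (differentiableAt_const _)
    (DifferentiableAt.fun_neg (DifferentiableAt.fun_sum fun j _ => (coord_diff j x).fun_mul (coord_diff j x))),
    pd_neg, pd_sum _ _ (fun j _ => (coord_diff j x).fun_mul (coord_diff j x))]
  have h0 : pd i (fun _ : EuclideanSpace ℝ (Fin n) => ρ ^ 2) x = 0 := by
    unfold pd; simp
  have h1 : ∀ j, pd i (fun y : EuclideanSpace ℝ (Fin n) => y j * y j) x 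
      = if j = i then 2 * x j else 0 := by
    intro j
    rw [pd_mul i (coord_diff j x) (coord_diff j x), pd_coord]
    split_ifs <;> ring
  simp only [h0, h1]
  simp

theorem max_lemma (hn : 0 < n) (hU : IsOpen U) {ρ : ℝ} (hρ : 0 < ρ)
    (hsub : Metric.closedBall 0 ρ ⊆ U)
    {F : EuclideanSpace ℝ (Fin n) → ℝ} (hF : ContDiffOn ℝ (⊤ : ℕ∞) F U)
    {x1 : EuclideanSpace ℝ (Fin n)} (hx1 : x1 ∈ Metric.ball 0 ρ) (hF1 : 0 < F x1) :
    ∃ x0 ∈ Metric.ball (0 : EuclideanSpace ℝ (Fin n)) ρ, 0 < F x0 ∧ 0 < cut ρ x0 ∧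
      cut ρ x1 ^ 2 * F x1 ≤ cut ρ x0 ^ 2 * F x0 ∧
      (∀ i, cut ρ x0 * pd i F x0 = 4 * x0 i * F x0) ∧
      ∑ i, pd i (pd i F) x0 ≤ (24 + 4 * n) * (ρ / cut ρ x0) ^ 2 * F x0 := by
  set G : EuclideanSpace ℝ (Fin n) → ℝ := fun y => cut ρ y * (cut ρ y * F y) with hG
  have hGs : ContDiffOn ℝ (⊤ : ℕ∞) G U :=
    (cut_smooth ρ).contDiffOn.mul ((cut_smooth ρ).contDiffOn.mul hF)
  obtain ⟨x0, hx0, hmax⟩ := (isCompact_closedBall (0 : EuclideanSpace ℝ (Fin n)) ρ).exists_isMaxOn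
    ⟨x1, Metric.ball_subset_closedBall hx1⟩ (hGs.continuousOn.mono hsub)
  have cpos : ∀ y ∈ Metric.ball (0 : EuclideanSpace ℝ (Fin n)) ρ, 0 < cut ρ y := by
    intro y hy
    have : ‖y‖ < ρ := by simpa using hy
    unfold cut
    nlinarith [norm_nonneg y]
  have hle : G x1 ≤ G x0 := hmax (Metric.ball_subset_closedBall hx1)
  have hG1 : 0 < G x1 := mul_pos (cpos _ hx1) (mul_pos (cpos _ hx1) hF1)
  have hG0 : 0 < G x0 := hG1.trans_le hle
  have hx0n : ‖x0‖ ≤ ρ := by simpa using hx0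
  have hx0b : x0 ∈ Metric.ball (0 : EuclideanSpace ℝ (Fin n)) ρ := by
    rw [mem_ball_zero_iff]
    refine lt_of_le_of_ne hx0n fun h => ?_
    have : cut ρ x0 = 0 := by unfold cut; rw [h]; ring
    simp [hG, this] at hG0
  have hc := cpos _ hx0b
  have hF0 : 0 < F x0 := by
    have := pos_of_mul_pos_right hG0 hc.le
    exact pos_of_mul_pos_right this hc.le
  have hxU := hsub hx0
  have hloc : IsLocalMax G x0 := by
    filter_upwards [Metric.isOpen_ball.mem_nhds hx0b] with y hy
    exact hmax (Metric.ball_subset_closedBall hy)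
  have dF : ∀ y ∈ U, DifferentiableAt ℝ F y := fun y hy => sm_diff hU hF hy
  have p1 : ∀ i, ∀ y ∈ U, pd i G y = (-4) * (y i * (cut ρ y * F y)) 
      + cut ρ y * (cut ρ y * pd i F y) := by
    intro i y hy
    rw [hG, pd_mul i (cut_diff ρ y) ((cut_diff ρ y).fun_mul (dF y hy)), pd_mul i (cut_diff ρ y) (dF y hy),
      pd_cut]
    ring
  have p0 : ∀ i, cut ρ x0 * pd i F x0 = 4 * x0 i * F x0 := by
    intro i
    have h1 := p1 i x0 hxU
    have h2 : pd i G x0 = 0 := by unfold pd; rw [hloc.fderiv_eq_zero]; simp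
    rw [h2] at h1
    have : cut ρ x0 * (cut ρ x0 * pd i F x0 - 4 * x0 i * F x0) = 0 := by linarith
    rcases mul_eq_zero.1 this with h | h
    · exact absurd h hc.ne'
    · linarith
  have p2 : ∀ i, pd i (pd i G) x0 = (-4) * (cut ρ x0 * F x0) + 8 * x0 i ^ 2 * F x0 
      - 8 * x0 i * (cut ρ x0 * pd i F x0) + cut ρ x0 ^ 2 * pd i (pd i F) x0 := by
    intro i
    have dc := cut_diff ρ x0
    have dF0 := dF x0 hxU
    have dF1 : DifferentiableAt ℝ (pd i F) x0 := sm_diff hU (pd_smooth hU hF i) hxU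
    have dx := coord_diff i x0
    rw [pd_congr hU hxU (p1 i) i, 
      pd_add i ((dx.fun_mul (dc.fun_mul dF0)).const_mul (-4)) (dc.fun_mul (dc.fun_mul dF1)),
      pd_const_mul i (-4) (dx.fun_mul (dc.fun_mul dF0)), pd_mul i dx (dc.fun_mul dF0), pd_mul i dc dF0,
      pd_mul i dc (dc.fun_mul dF1), pd_mul i dc dF1, pd_cut, pd_coord]
    simp only [if_true]
    ring
  refine ⟨x0, hx0b, hF0, hc, ?_, p0, ?_⟩
  · have : ∀ y, cut ρ y ^ 2 * F y = G y := fun y => by simp only [hG]; ring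
    rw [this, this]; exact hle
  · have h3 : ∀ i, cut ρ x0 ^ 2 * pd i (pd i F) x0 ≤ 4 * (cut ρ x0 * F x0) + 24 * F x0 * x0 i ^ 2 := by
      intro i
      have := pd_pd_nonpos hU hGs hxU i hloc
      rw [p2, p0] at this
      linarith
    have h4 : cut ρ x0 ^ 2 * ∑ i, pd i (pd i F) x0 
        ≤ n * (4 * (cut ρ x0 * F x0)) + 24 * F x0 * ∑ i, x0 i ^ 2 := by
      rw [Finset.mul_sum]
      refine (Finset.sum_le_sum fun i _ => h3 i).trans_eq ?_
      rw [Finset.sum_add_distrib, ← Finset.mul_sum _ _ (24 * F x0)]; simp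
    have h5 : ∑ i, x0 i ^ 2 = ‖x0‖ ^ 2 := by rw [EuclideanSpace.norm_sq_eq]; simp
    rw [h5] at h4
    have h6 : ‖x0‖ ^ 2 ≤ ρ ^ 2 := by gcongr
    have h7 : cut ρ x0 ≤ ρ ^ 2 := by unfold cut; nlinarith [sq_nonneg ‖x0‖]
    have e : (24 + 4 * (n:ℝ)) * (ρ / cut ρ x0) ^ 2 * F x0 
        = ((24 + 4 * n) * ρ ^ 2 * F x0) / cut ρ x0 ^ 2 := by
      field_simp
    rw [e, le_div_iff₀ (by positivity)]
    have h8 : F x0 * ‖x0‖ ^ 2 ≤ F x0 * ρ ^ 2 := mul_le_mul_of_nonneg_left h6 hF0.le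
    have h9 : (n * F x0) * cut ρ x0 ≤ (n * F x0) * ρ ^ 2 := 
      mul_le_mul_of_nonneg_left h7 (by positivity)
    linarith

theorem grad_est (hn : 3 ≤ n) (hU : IsOpen U) {ρ : ℝ} (hρ : 0 < ρ)
    (hsub : Metric.closedBall 0 ρ ⊆ U)
    {w φ φ' : EuclideanSpace ℝ (Fin n) → ℝ} {θ : ℝ} (hθ : 0 < θ)
    (hw : ContDiffOn ℝ (⊤ : ℕ∞) w U) (hφ : ∀ y ∈ U, DifferentiableAt ℝ φ y)
    (hφ' : ∀ y ∈ U, ∀ i, pd i φ y = φ' y * pd i w y)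
    (heq : ∀ y ∈ U, ∑ i, pd i (pd i w) y = -(gsq w y + φ y))
    (hφ0 : ∀ y ∈ U, 0 ≤ φ y)
    (hs : ∀ y ∈ U, ∀ s : ℝ, 0 < s → θ * (s + φ y) ^ 2 ≤ (s + φ y) ^ 2 - ((n:ℝ) - 1) * φ' y * s)
    {x1 : EuclideanSpace ℝ (Fin n)} (hx1 : x1 ∈ Metric.ball 0 ρ) :
    cut ρ x1 ^ 2 * gsq w x1 ≤ 
      (((n:ℝ) - 1) / θ * (24 + 4 * n) + 36 * (((n:ℝ) - 1) / θ) ^ 2) * ρ ^ 2 := by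
  have hN : (2:ℝ) ≤ (n:ℝ) - 1 := by
    have : (3:ℝ) ≤ n := by exact_mod_cast hn
    linarith
  by_cases hF1 : 0 < gsq w x1
  swap
  · have : cut ρ x1 ^ 2 * gsq w x1 ≤ 0 := 
      mul_nonpos_of_nonneg_of_nonpos (sq_nonneg _) (not_lt.1 hF1)
    refine this.trans ?_
    have : 0 ≤ ((n:ℝ) - 1) / θ := div_nonneg (by linarith) hθ.le
    positivity
  obtain ⟨x0, hx0, hF0, hc, hle, hgrad, hlap⟩ := max_lemma (by omega) hU hρ hsub 
    (gsq_smooth hU hw) hx1 hF1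
  refine hle.trans ?_
  have hxU := hsub (Metric.ball_subset_closedBall hx0)
  have hb := bochner hU hw hxU (hφ x0 hxU) (hφ' x0 hxU) heq
  set F := gsq w x0 with hFdef
  set c := cut ρ x0 with hcdef
  have hu : ∑ i, pd i w x0 ^ 2 = F := by
    rw [hFdef]; unfold gsq; exact Finset.sum_congr rfl fun i _ => by ring
  set t := 2 * (∑ i, x0 i * pd i w x0) / c with ht
  have hFt : ∑ k, ∑ i, pd k (pd i w) x0 * (pd k w x0 * pd i w x0) = F * t := by
    have h1 : ∀ k, ∑ i, pd k (pd i w) x0 * (pd k w x0 * pd i w x0) 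
        = F * (2 / c) * (x0 k * pd k w x0) := by
      intro k
      have h2 := hgrad k
      rw [pd_gsq hU hw hxU] at h2
      have h3 : ∑ i, 2 * (pd i w x0 * pd k (pd i w) x0) = 4 * x0 k * F / c := by
        rw [eq_div_iff hc.ne']; linarith
      have h4 : ∑ i, pd k (pd i w) x0 * (pd k w x0 * pd i w x0) 
          = pd k w x0 / 2 * ∑ i, 2 * (pd i w x0 * pd k (pd i w) x0) := by
        rw [Finset.mul_sum]; exact Finset.sum_congr rfl fun i _ => by ring
      rw [h4, h3]; ring
    simp only [h1, ← Finset.mul_sum]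
    rw [ht]; ring
  have hH := hess_ineq hn (fun k i => pd k (pd i w) x0) (fun i => pd i w x0) F t _ hF0 hu hFt rfl
  have hcs : |∑ i, x0 i * pd i w x0| ≤ ρ * √F := by
    apply abs_le_of_sq_le_sq _ (by positivity)
    have h1 := Finset.sum_mul_sq_le_sq_mul_sq Finset.univ (fun i => x0 i) (fun i => pd i w x0)
    rw [hu] at h1
    have h5 : ∑ i, x0 i ^ 2 = ‖x0‖ ^ 2 := by rw [EuclideanSpace.norm_sq_eq]; simp
    have h6 : ‖x0‖ ≤ ρ := by
      have := mem_ball_zero_iff.1 hx0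
      exact this.le
    rw [h5] at h1
    refine h1.trans ?_
    rw [mul_pow, Real.sq_sqrt hF0.le]
    gcongr
  have htb : |t| ≤ 2 * (ρ / c) * √F := by
    rw [ht, abs_div, abs_mul, abs_of_pos hc, abs_of_pos (two_pos : (0:ℝ) < 2), div_le_iff₀ hc]
    have : 2 * (ρ / c) * √F * c = 2 * (ρ * √F) := by field_simp
    rw [this]; linarith
  have key := real_core ((n:ℝ) - 1) F (φ x0) (φ' x0) t _ _ _ (ρ / c) (√F) (24 + 4 * n) θ hN hF0
    (hφ0 x0 hxU) hθ (Real.sqrt_nonneg _) (Real.sq_sqrt hF0.le) (by positivity) (by positivity)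
    hH (heq x0 hxU) (by rw [hb, hFt]; ring) (hs x0 hxU F hF0) hlap htb
  have := mul_le_mul_of_nonneg_left key (sq_nonneg c)
  refine this.trans_eq ?_
  field_simp

end bochner

theorem real_f (n : ℕ) (hn : 3 ≤ n) (p δ μ a b q v : ℝ) (hp0 : 0 < p)
    (ha : 0 < a) (hb : 0 < b) (hq : 1 ≤ q) (h1 : max (-a) (-b) < μ) (h2 : μ < 0)
    (hδ : δ = μ / max (-a) (-b)) (hv : 0 < v)
    (θ : ℝ) (hθ0 : 0 < θ) (hθ1 : 4 * θ ≤ 2)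
    (hθ2 : 4 * θ ≤ 4 * (1 - δ) - ((n:ℝ) - 1) * p) :
    0 ≤ μ + a * v ^ p + b * v ^ (-q) ∧
    ∀ s : ℝ, 0 < s → θ * (s + (μ + a * v ^ p + b * v ^ (-q))) ^ 2 ≤ 
      (s + (μ + a * v ^ p + b * v ^ (-q))) ^ 2 
        - ((n:ℝ) - 1) * (p * (a * v ^ p) - q * (b * v ^ (-q))) * s := by
  have hN : (2:ℝ) ≤ (n:ℝ) - 1 := by
    have : (3:ℝ) ≤ n := by exact_mod_cast hn
    linarith
  set M := max (-a) (-b) with hM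
  have hM0 : M < 0 := max_lt (by linarith) (by linarith)
  have hμ : μ = δ * M := by rw [hδ, div_mul_cancel₀ _ hM0.ne]
  have hδ0 : 0 < δ := by rw [hδ]; exact div_pos_of_neg_of_neg h2 hM0
  have hMa : -a ≤ M := le_max_left _ _
  have hMb : -b ≤ M := le_max_right _ _
  set A := a * v ^ p with hA
  set B := b * v ^ (-q) with hB
  have hA0 : 0 < A := by positivity
  have hB0 : 0 < B := by positivity
  have hAB : a ≤ A ∨ b ≤ B := by
    rcases le_total 1 v with h | h
    · left
      have := Real.one_le_rpow h hp0.le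
      rw [hA]; nlinarith
    · right
      have := Real.one_le_rpow_of_pos_of_le_one_of_nonpos hv h (show -q ≤ 0 by linarith)
      rw [hB]; nlinarith
  have hqB : 2 * B ≤ ((n:ℝ) - 1) * q * B := by
    have : 2 ≤ ((n:ℝ) - 1) * q := by nlinarith
    nlinarith
  have hpA : ((n:ℝ) - 1) * p * A ≤ (4 * (1 - δ) - 4 * θ) * A := 
    mul_le_mul_of_nonneg_right (by linarith) hA0.le
  have hf0 : 0 ≤ μ + A + B := by rcases hAB with h | h <;> linarith
  have hθA : 0 ≤ θ * A := by positivity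
  have hθB : 4 * θ * B ≤ 2 * B := mul_le_mul_of_nonneg_right hθ1 hB0.le
  have hθμ : θ * μ ≤ 0 := by nlinarith
  have hkey : 4 * θ * (μ + A + B) ≤ 4 * (μ + A + B) - ((n:ℝ) - 1) * (p * A - q * B) := by
    have hor : 0 ≤ μ + δ * A + B := by
      rcases hAB with h | h
      · have : 0 ≤ δ * (A + M) := mul_nonneg hδ0.le (by linarith)
        rw [hμ]; linarith
      · have : 0 ≤ δ * A := by positivity
        linarith
    linarith
  refine ⟨hf0, fun s hs => ?_⟩
  set f := μ + A + B
  have h3 := mul_le_mul_of_nonneg_right hkey hs.le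
  have h4 : 0 ≤ (1 - θ) * (s - f) ^ 2 := mul_nonneg (by linarith) (sq_nonneg _)
  linarith

theorem stmt_1 (n : ℕ) (hn : 3 ≤ n) (p δ : ℝ)
    (hp : 0 < p ∧ p < 4 / ((n : ℝ) - 1) * (1 - δ)) :
    ∃ C : ℝ, 0 < C ∧
      ∀ μ a b q : ℝ, 0 < a → 0 < b → 1 ≤ q →
        max (-a) (-b) < μ → μ < 0 → δ = μ / max (-a) (-b) →
        ∀ R : ℝ, 0 < R →
          ∀ v : EuclideanSpace ℝ (Fin n) → ℝ, ContDiff ℝ (⊤ : ℕ∞) v →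
            (∀ x ∈ Metric.ball (0 : EuclideanSpace ℝ (Fin n)) R, 0 < v x) →
            (∀ x ∈ Metric.ball (0 : EuclideanSpace ℝ (Fin n)) R,
              lap v x + μ * v x + a * v x ^ (p + 1) + b * v x ^ (1 - q) = 0) →
            ∀ x ∈ Metric.ball (0 : EuclideanSpace ℝ (Fin n)) (R / 2),
              ‖gradient v x‖ ^ 2 / (v x) ^ 2 ≤ C / R ^ 2 := by
  have hN : (2:ℝ) ≤ (n:ℝ) - 1 := by
    have : (3:ℝ) ≤ n := by exact_mod_cast hn
    linarith
  have hε : 0 < 4 * (1 - δ) - ((n:ℝ) - 1) * p := by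
    have := hp.2
    rw [div_mul_eq_mul_div, lt_div_iff₀ (by linarith)] at this
    linarith
  set ε := 4 * (1 - δ) - ((n:ℝ) - 1) * p with hεd
  set θ := min (ε / 4) (1 / 2) with hθd
  have hθ0 : 0 < θ := lt_min (by linarith) (by norm_num)
  have hθ1 : θ ≤ ε / 4 := min_le_left _ _
  have hθ2 : θ ≤ 1 / 2 := min_le_right _ _
  set C0 := ((n:ℝ) - 1) / θ * (24 + 4 * n) + 36 * (((n:ℝ) - 1) / θ) ^ 2 with hC0d
  have hC0 : 0 < C0 := by
    have : 0 < ((n:ℝ) - 1) / θ := div_pos (by linarith) hθ0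
    positivity
  refine ⟨6 * C0, by positivity, ?_⟩
  intro μ a b q ha hb hq h1 h2 hδ R hR v hv hpos hpde x hx
  set U := Metric.ball (0 : EuclideanSpace ℝ (Fin n)) R with hUd
  have hU : IsOpen U := Metric.isOpen_ball
  set w : EuclideanSpace ℝ (Fin n) → ℝ := fun y => Real.log (v y) with hwd
  have hvs : ContDiffOn ℝ (⊤ : ℕ∞) v U := hv.contDiffOn
  have hw : ContDiffOn ℝ (⊤ : ℕ∞) w U := hvs.log fun y hy => (hpos y hy).ne'
  have dv : ∀ y, DifferentiableAt ℝ v y := fun y => hv.differentiable (by simp) y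
  have hpw : ∀ i, ∀ y ∈ U, pd i w y = (v y)⁻¹ * pd i v y := fun i y hy =>
    pd_comp i (Real.hasDerivAt_log (hpos y hy).ne') (dv y)
  have hppw : ∀ i, ∀ y ∈ U, pd i (pd i w) y = (v y)⁻¹ * pd i (pd i v) y - pd i w y * pd i w y := by
    intro i y hy
    have hne := (hpos y hy).ne'
    rw [pd_congr hU hy (hpw i) i, pd_mul i ((dv y).fun_inv hne) (sm_diff hU (pd_smooth hU hvs i) hy),
      pd_comp i (k := fun z => z⁻¹) (hasDerivAt_inv hne) (dv y), hpw i y hy]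
    field_simp
    ring
  set φ : EuclideanSpace ℝ (Fin n) → ℝ := fun y => μ + a * v y ^ p + b * v y ^ (-q) with hφd
  set φ' : EuclideanSpace ℝ (Fin n) → ℝ := 
    fun y => p * (a * v y ^ p) - q * (b * v y ^ (-q)) with hφ'd
  have hk : ∀ y ∈ U, HasDerivAt (fun z : ℝ => μ + a * z ^ p + b * z ^ (-q)) 
      (φ' y * (v y)⁻¹) (v y) := by
    intro y hy
    have hy0 := hpos y hy
    have e1 := Real.hasDerivAt_rpow_const (x := v y) (p := p) (Or.inl hy0.ne')
    have e2 := Real.hasDerivAt_rpow_const (x := v y) (p := -q) (Or.inl hy0.ne')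
    have := ((e1.const_mul a).const_add μ).add (e2.const_mul b)
    refine this.congr_deriv ?_
    rw [Real.rpow_sub_one hy0.ne', Real.rpow_sub_one hy0.ne']
    simp only [hφ'd]
    field_simp
    ring
  have hmain := grad_est (U := U) hn hU (ρ := 3 * R / 4) (by positivity) 
    (Metric.closedBall_subset_ball (by linarith)) (w := w) (φ := φ) (φ' := φ') hθ0 hw
    (fun y hy => ((hk y hy).differentiableAt.comp y (dv y) : _))
    (fun y hy i => by
      rw [hpw i y hy]
      have := pd_comp i (hk y hy) (dv y)
      rw [← mul_assoc, ← this])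
    (fun y hy => by
      simp only [hppw _ y hy, Finset.sum_sub_distrib, ← Finset.mul_sum]
      have e := hpde y hy
      have hy0 := hpos y hy
      have e0 : ∑ i, pd i (pd i v) y = lap v y := rfl
      rw [e0]
      have e1 : v y ^ (p + 1) = v y ^ p * v y := Real.rpow_add_one hy0.ne' p
      have e2 : v y ^ (1 - q) = v y ^ (-q) * v y := by
        rw [← Real.rpow_add_one hy0.ne']; congr 1; ring
      rw [e1, e2] at e
      have e3 : lap v y = - (φ y) * v y := by simp only [hφd]; linarith
      rw [e3]
      have e4 : (v y)⁻¹ * (-φ y * v y) = - φ y := by field_simp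
      rw [e4]
      unfold gsq
      ring)
    (fun y hy => (real_f n hn p δ μ a b q (v y) hp.1 ha hb hq h1 h2 hδ (hpos y hy) θ hθ0
      (by linarith) (by linarith)).1)
    (fun y hy => (real_f n hn p δ μ a b q (v y) hp.1 ha hb hq h1 h2 hδ (hpos y hy) θ hθ0
      (by linarith) (by linarith)).2)
    (x1 := x) (Metric.ball_subset_ball (by linarith) hx)
  have hxU : x ∈ U := Metric.ball_subset_ball (by linarith) hx
  have hx0 := hpos x hxU
  have hgs : ‖gradient v x‖ ^ 2 / (v x) ^ 2 = gsq w x := by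
    rw [grad_sq, Finset.sum_div]
    unfold gsq
    refine Finset.sum_congr rfl fun i _ => ?_
    rw [hpw i x hxU]; field_simp
  rw [hgs, le_div_iff₀ (by positivity)]
  have hxn : ‖x‖ < R / 2 := mem_ball_zero_iff.1 hx
  have hg0 : 0 ≤ gsq w x := Finset.sum_nonneg fun i _ => mul_self_nonneg _
  have hcut : 5 / 16 * R ^ 2 ≤ cut (3 * R / 4) x := by
    unfold cut
    have : ‖x‖ ^ 2 ≤ (R / 2) ^ 2 := by gcongr
    linarith
  have hsq : (5 / 16 * R ^ 2) ^ 2 ≤ cut (3 * R / 4) x ^ 2 := by gcongr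
  have h3 := (mul_le_mul_of_nonneg_right hsq hg0).trans hmain
  have h4 : R ^ 2 * (25 / 256 * (gsq w x * R ^ 2)) ≤ R ^ 2 * (C0 * (9 / 16)) := by linarith
  have h5 := le_of_mul_le_mul_left h4 (by positivity)
  linarith
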